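/- For i = 1,...,n−1, α = 1,...,m, and distinct complex numbers c, c', the elements of ℂG̃_n satisfy the reflection-type equation s_i(c,c') · g_i^{(α)}(c) · s_i · g_i^{(α)}(c') = g_i^{(α)}(c') · s_i · g_i^{(α)}(c) · s_i(c,c'), where s_i(c,c') = s_i + e_{i,i+1}/(c−c') and g_i^{(α)}(v) = ∏_{ξ∈S^{(α)}}(v−ξ) · (v − g_i^{(α)})^{-1} (a polynomial in g_i^{(α)} with coefficients depending on v). -/

import Mathlib

/-- The action of the symmetric group `S_n` on `G^n` permuting the copies of `G`. -/
def permHom (n : ℕ) (G : Type) [Group G] : Equiv.Perm (Fin n) →* MulAut (Fin n → G) where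
  toFun σ :=
    { Equiv.arrowCongr σ (Equiv.refl G) with
      map_mul' := fun _ _ => rfl }
  map_one' := MulEquiv.ext fun _ => rfl
  map_mul' := fun _ _ => MulEquiv.ext fun _ => rfl

/-- The wreath product `G̃_n = G^n ⋊ S_n` of `G` by the symmetric group. -/
abbrev Wreath (n : ℕ) (G : Type) [Group G] :=
  SemidirectProduct (Fin n → G) (Equiv.Perm (Fin n)) (permHom n G)

noncomputable section

/-- The element `s_a` of `ℂG̃_n`: the simple transposition of `a` and `a+1`
(0-based indexing) in the symmetric-group part.  (Junk value `1` out of range.) -/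
def sE (n : ℕ) (G : Type) [Group G] (a : ℕ) : MonoidAlgebra ℂ (Wreath n G) :=
  if h : a + 1 < n then
    MonoidAlgebra.of ℂ (Wreath n G)
      (SemidirectProduct.inr (Equiv.swap ⟨a, Nat.lt_of_succ_lt h⟩ ⟨a + 1, h⟩))
  else 1

/-- The element `e_{i,j} = (1/|G|) Σ_{g ∈ G} g_i g_j⁻¹` of `ℂG̃_n` (0-based indexing),
where `g_i` is the image of `g` in the `i`-th copy of `G`.  (Junk value `1` out of range;
note `e_{i,i} = 1`.) -/
def eE (n : ℕ) (G : Type) [Group G] [Fintype G] (i j : ℕ) : MonoidAlgebra ℂ (Wreath n G) :=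
  if h : i < n ∧ j < n then
    ((Fintype.card G : ℂ))⁻¹ • ∑ g : G,
      MonoidAlgebra.of ℂ (Wreath n G)
        (SemidirectProduct.inl (Pi.mulSingle ⟨i, h.1⟩ g * Pi.mulSingle ⟨j, h.2⟩ g⁻¹))
  else 1

/-- The image `g_l` in `ℂG̃_n` of an element `g ∈ G` placed in the `l`-th copy of `G`
(0-based indexing; junk value `1` out of range). -/
def gE (n : ℕ) (G : Type) [Group G] (l : ℕ) (g : G) : MonoidAlgebra ℂ (Wreath n G) :=
  if h : l < n then
    MonoidAlgebra.of ℂ (Wreath n G) (SemidirectProduct.inl (Pi.mulSingle ⟨l, h⟩ g))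
  else 1

/-- The image `g_i^{(α)}` in `ℂG̃_n` of the normalized class sum
`g^{(α)} = (1/|C_α|) Σ_{g ∈ C_α} g` placed in the `i`-th copy of `G`
(0-based indexing; junk value `1` out of range). -/
def gClassE (n : ℕ) (G : Type) [Group G] [Fintype G] (i : ℕ) (c : ConjClasses G) :
    MonoidAlgebra ℂ (Wreath n G) :=
  if h : i < n then
    (((Set.toFinite (ConjClasses.carrier c)).toFinset.card : ℂ))⁻¹ •
      ∑ g ∈ (Set.toFinite (ConjClasses.carrier c)).toFinset,
        MonoidAlgebra.of ℂ (Wreath n G) (SemidirectProduct.inl (Pi.mulSingle ⟨i, h⟩ g))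
  else 1

end

open Polynomial

/-- The Baxterized element `s_a(c,c') = s_a + e_{a,a+1}/(c−c')` of `ℂG̃_n`. -/
noncomputable def sBax (n : ℕ) (G : Type) [Group G] [Fintype G] (a : ℕ) (c c' : ℂ) :
    MonoidAlgebra ℂ (Wreath n G) :=
  sE n G a + (c - c')⁻¹ • eE n G a (a + 1)

/-- The polynomial expression `g_i^{(α)}(v) = Σ_{t=0}^{k−1} 𝔞_{t+1}(v) (g_i^{(α)})^t`
for the rational function `∏_{ξ ∈ S^{(α)}}(v − ξ)/(v − g_i^{(α)})`, where
`∏_{ξ ∈ S^{(α)}}(X − ξ) = Σ_j a_j X^j` and `𝔞_t(v) = a_t + a_{t+1} v + ⋯ + a_k v^{k−t}`,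
`k = |S^{(α)}|`. -/
noncomputable def gBax (n : ℕ) (G : Type) [Group G] [Fintype G] (i : ℕ)
    (c : ConjClasses G) (S : Finset ℂ) (v : ℂ) : MonoidAlgebra ℂ (Wreath n G) :=
  ∑ t ∈ Finset.range S.card,
    (∑ j ∈ Finset.range (S.card + 1 - (t + 1)),
        (∏ ξ ∈ S, (X - C ξ)).coeff (t + 1 + j) * v ^ j) • (gClassE n G i c) ^ t

/-- The `l`-th copy of `G` inside `ℂG̃_n`. -/
noncomputable def copyU (n : ℕ) (G : Type) [Group G] (l : Fin n) :
    G →* MonoidAlgebra ℂ (Wreath n G) :=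
  (MonoidAlgebra.of ℂ (Wreath n G)).comp
    (SemidirectProduct.inl.comp (MonoidHom.mulSingle (fun _ : Fin n => G) l))

theorem copyU_commute (n : ℕ) (G : Type) [Group G] {l k : Fin n} (h : l ≠ k) (a b : G) :
    Commute (copyU n G l a) (copyU n G k b) := by
  have := (Pi.mulSingle_commute (f := fun _ : Fin n => G) h a b)
  exact (this.map (SemidirectProduct.inl (φ := permHom n G))).map
    (MonoidAlgebra.of ℂ (Wreath n G))

theorem gClassE_eq (n : ℕ) (G : Type) [Group G] [Fintype G] (i : ℕ) (h : i < n)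
    (c : ConjClasses G) : gClassE n G i c =
    (((Set.toFinite (ConjClasses.carrier c)).toFinset.card : ℂ))⁻¹ •
      ∑ g ∈ (Set.toFinite (ConjClasses.carrier c)).toFinset, copyU n G ⟨i, h⟩ g := by
  rw [gClassE, dif_pos h]; rfl

theorem eE_eq (n : ℕ) (G : Type) [Group G] [Fintype G] (i j : ℕ) (h : i < n) (h' : j < n) :
    eE n G i j = ((Fintype.card G : ℂ))⁻¹ • ∑ g : G,
      copyU n G ⟨i, h⟩ g * copyU n G ⟨j, h'⟩ g⁻¹ := by
  rw [eE, dif_pos ⟨h, h'⟩]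
  congr 1
  refine Finset.sum_congr rfl fun g _ => ?_
  rw [map_mul, map_mul]; rfl

theorem eE_semiconj (n : ℕ) (G : Type) [Group G] [Fintype G] (i j : ℕ) (h : i < n) (h' : j < n)
    (hij : i ≠ j) (a : G) :
    SemiconjBy (eE n G i j) (copyU n G ⟨i, h⟩ a) (copyU n G ⟨j, h'⟩ a) := by
  have hne : (⟨i, h⟩ : Fin n) ≠ ⟨j, h'⟩ := by simpa using hij
  rw [SemiconjBy, eE_eq n G i j h h', smul_mul_assoc, mul_smul_comm, Finset.sum_mul,
    Finset.mul_sum]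
  congr 1
  refine Fintype.sum_equiv (Equiv.mulRight a) _ _ fun g => ?_
  simp only [Equiv.coe_mulRight]
  rw [← mul_assoc, ← (copyU_commute n G hne _ _).eq, mul_assoc, mul_assoc, ← map_mul,
    ← (copyU_commute n G hne _ _).eq, ← mul_assoc, ← map_mul]
  simp

theorem eE_semiconj' (n : ℕ) (G : Type) [Group G] [Fintype G] (i j : ℕ) (h : i < n) (h' : j < n)
    (a : G) :
    SemiconjBy (eE n G i j) (copyU n G ⟨j, h'⟩ a) (copyU n G ⟨i, h⟩ a) := by
  rw [SemiconjBy, eE_eq n G i j h h', smul_mul_assoc, mul_smul_comm, Finset.sum_mul,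
    Finset.mul_sum]
  congr 1
  refine Fintype.sum_equiv (Equiv.mulLeft a⁻¹) _ _ fun g => ?_
  simp only [Equiv.coe_mulLeft]
  rw [← mul_assoc, ← map_mul, mul_assoc, ← map_mul]
  simp

theorem semiconj_gClassE (n : ℕ) (G : Type) [Group G] [Fintype G] (i j : ℕ) (h : i < n)
    (h' : j < n) (c : ConjClasses G) (r : MonoidAlgebra ℂ (Wreath n G))
    (hr : ∀ a, SemiconjBy r (copyU n G ⟨i, h⟩ a) (copyU n G ⟨j, h'⟩ a)) :
    SemiconjBy r (gClassE n G i c) (gClassE n G j c) := by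
  rw [SemiconjBy, gClassE_eq n G i h, gClassE_eq n G j h', smul_mul_assoc, mul_smul_comm,
    Finset.sum_mul, Finset.mul_sum]
  congr 1
  exact Finset.sum_congr rfl fun g _ => hr g

theorem copyU_commute_gClassE (n : ℕ) (G : Type) [Group G] [Fintype G] (i : ℕ) (h : i < n)
    (c : ConjClasses G) (l : Fin n) (a : G) :
    Commute (copyU n G l a) (gClassE n G i c) := by
  by_cases hl : l = ⟨i, h⟩
  · subst hl
    rw [Commute, SemiconjBy, gClassE_eq n G i h, smul_mul_assoc, mul_smul_comm,
      Finset.sum_mul, Finset.mul_sum]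
    congr 1
    refine Finset.sum_equiv (MulAut.conj a).toEquiv (fun g => ?_) (fun g _ => ?_)
    · simp only [Set.Finite.mem_toFinset, ConjClasses.mem_carrier_iff_mk_eq]
      have : ConjClasses.mk ((MulAut.conj a).toEquiv g) = ConjClasses.mk g :=
        ConjClasses.mk_eq_mk_iff_isConj.2 (isConj_iff.2 ⟨a⁻¹, by simp [mul_assoc]⟩)
      rw [this]
    · rw [← map_mul, ← map_mul]
      simp
  · exact semiconj_gClassE n G i i h h c _ fun b => copyU_commute n G hl a b

theorem eE_commute_gClassE (n : ℕ) (G : Type) [Group G] [Fintype G] (i j k : ℕ) (h : i < n)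
    (h' : j < n) (hk : k < n) (c : ConjClasses G) :
    Commute (eE n G i j) (gClassE n G k c) := by
  rw [eE_eq n G i j h h']
  refine Commute.smul_left (Commute.sum_left _ _ _ fun g _ => ?_) _
  exact (copyU_commute_gClassE n G k hk c _ _).mul_left (copyU_commute_gClassE n G k hk c _ _)

theorem inr_swap_semiconj (n : ℕ) (G : Type) [Group G] (σ : Equiv.Perm (Fin n)) (l : Fin n)
    (a : G) :
    SemiconjBy (MonoidAlgebra.of ℂ (Wreath n G) (SemidirectProduct.inr σ))
      (copyU n G l a) (copyU n G (σ l) a) := by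
  have key : SemiconjBy (SemidirectProduct.inr σ : Wreath n G)
      (SemidirectProduct.inl (Pi.mulSingle l a)) (SemidirectProduct.inl (Pi.mulSingle (σ l) a)) := by
    have h1 : permHom n G σ (Pi.mulSingle l a) = Pi.mulSingle (σ l) a := by
      funext k
      change (Pi.mulSingle l a : Fin n → G) (σ.symm k) = _
      by_cases hk : k = σ l
      · subst hk; simp
      · rw [Pi.mulSingle_eq_of_ne hk, Pi.mulSingle_eq_of_ne]
        intro h; exact hk (by rw [← h]; simp)
    rw [SemiconjBy, ← h1, SemidirectProduct.inl_aut]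
    simp [mul_assoc]
  exact key.map (MonoidAlgebra.of ℂ (Wreath n G))

theorem semiconj_gBax (n : ℕ) (G : Type) [Group G] [Fintype G] (i j : ℕ) (c : ConjClasses G)
    (S : Finset ℂ) (v : ℂ) (r : MonoidAlgebra ℂ (Wreath n G))
    (hr : SemiconjBy r (gClassE n G i c) (gClassE n G j c)) :
    SemiconjBy r (gBax n G i c S v) (gBax n G j c S v) := by
  rw [SemiconjBy, gBax, gBax, Finset.sum_mul, Finset.mul_sum]
  refine Finset.sum_congr rfl fun t _ => ?_
  rw [smul_mul_assoc, mul_smul_comm, (hr.pow_right t).eq]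

theorem reflection_abstract {R : Type*} [Ring R] [Algebra ℂ R] (s e A A' B B' : R) (k : ℂ)
    (hs : s * s = 1) (hsA : s * A = B * s) (hsA' : s * A' = B' * s) (hsB : s * B = A * s)
    (hse : s * e = e * s) (heA : e * A = A * e) (heA' : e * A' = A' * e)
    (heB : e * B = A * e) (heB' : e * B' = A' * e) (hBe : B * e = e * A)
    (hAB : A * B' = B' * A) (hAB' : A' * B = B * A') :
    (s + k • e) * A * s * A' = A' * s * A * (s + k • e) := by
  have h1 : s * A * s * A' = A' * s * A * s := by
    rw [mul_assoc A', hsA, mul_assoc, mul_assoc B, ← mul_assoc s s, hs, one_mul, mul_assoc A',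
      mul_assoc B, hs, mul_one, hAB']
  have h2 : e * A * s * A' = A' * s * A * e := by
    calc e * A * s * A' = e * (A * B') * s := by simp only [mul_assoc, hsA']
      _ = (e * B') * A * s := by rw [hAB]; simp only [mul_assoc]
      _ = A' * (e * A) * s := by rw [heB']; simp only [mul_assoc]
      _ = A' * B * (e * s) := by rw [← hBe]; simp only [mul_assoc]
      _ = A' * (B * s) * e := by rw [← hse]; simp only [mul_assoc]
      _ = A' * s * A * e := by rw [← hsA]; simp only [mul_assoc]
  rw [add_mul, add_mul, add_mul, mul_add, h1, smul_mul_assoc, smul_mul_assoc, smul_mul_assoc,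
    mul_smul_comm, h2]

/-- Reflection-type equation in `ℂG̃_n`:
`s_i(c,c') g_i^{(α)}(c) s_i g_i^{(α)}(c') = g_i^{(α)}(c') s_i g_i^{(α)}(c) s_i(c,c')`,
where `S^{(α)}` is the set of distinct eigenvalues of the class sum, so that
`∏_{ξ ∈ S^{(α)}} (g_i^{(α)} − ξ) = 0`. -/
theorem baxterized_reflection (n : ℕ) (G : Type) [Group G] [Fintype G]
    (i : ℕ) (hi : i + 1 < n) (cc : ConjClasses G) (S : Finset ℂ)
    (hvan : Polynomial.aeval (gClassE n G i cc) (∏ ξ ∈ S, (X - C ξ)) = 0)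
    (c c' : ℂ) (hcc : c ≠ c') :
    sBax n G i c c' * gBax n G i cc S c * sE n G i * gBax n G i cc S c' =
      gBax n G i cc S c' * sE n G i * gBax n G i cc S c * sBax n G i c c' := by
  have h0 : i < n := by omega
  have hne : i ≠ i + 1 := by omega
  have hsdef : sE n G i = MonoidAlgebra.of ℂ (Wreath n G)
      (SemidirectProduct.inr (Equiv.swap ⟨i, h0⟩ ⟨i + 1, hi⟩)) := by
    rw [sE, dif_pos hi]
  have hs0 : ∀ a, SemiconjBy (sE n G i) (copyU n G ⟨i, h0⟩ a) (copyU n G ⟨i + 1, hi⟩ a) := by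
    intro a
    have := inr_swap_semiconj n G (Equiv.swap ⟨i, h0⟩ ⟨i + 1, hi⟩) ⟨i, h0⟩ a
    rwa [Equiv.swap_apply_left, ← hsdef] at this
  have hs1 : ∀ a, SemiconjBy (sE n G i) (copyU n G ⟨i + 1, hi⟩ a) (copyU n G ⟨i, h0⟩ a) := by
    intro a
    have := inr_swap_semiconj n G (Equiv.swap ⟨i, h0⟩ ⟨i + 1, hi⟩) ⟨i + 1, hi⟩ a
    rwa [Equiv.swap_apply_right, ← hsdef] at this
  have hsx := semiconj_gClassE n G i (i + 1) h0 hi cc _ hs0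
  have hsy := semiconj_gClassE n G (i + 1) i hi h0 cc _ hs1
  have hex := eE_commute_gClassE n G i (i + 1) i h0 hi h0 cc
  have hexy := semiconj_gClassE n G i (i + 1) h0 hi cc _ (eE_semiconj n G i (i + 1) h0 hi hne)
  have heyx := semiconj_gClassE n G (i + 1) i hi h0 cc _ (eE_semiconj' n G i (i + 1) h0 hi)
  have hxy : Commute (gClassE n G i cc) (gClassE n G (i + 1) cc) := by
    rw [gClassE_eq n G i h0]
    exact Commute.smul_left (Commute.sum_left _ _ _ fun g _ =>
      copyU_commute_gClassE n G (i + 1) hi cc _ _) _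
  have hAB : ∀ v w, Commute (gBax n G i cc S v) (gBax n G (i + 1) cc S w) := fun v w =>
    semiconj_gBax n G (i + 1) (i + 1) cc S w _
      (semiconj_gBax n G i i cc S v _ hxy.symm).symm
  refine reflection_abstract (sE n G i) (eE n G i (i + 1)) (gBax n G i cc S c)
    (gBax n G i cc S c') (gBax n G (i + 1) cc S c) (gBax n G (i + 1) cc S c') _ ?_
    (semiconj_gBax n G _ _ cc S _ _ hsx) (semiconj_gBax n G _ _ cc S _ _ hsx)
    (semiconj_gBax n G _ _ cc S _ _ hsy) ?_
    (semiconj_gBax n G _ _ cc S _ _ hex) (semiconj_gBax n G _ _ cc S _ _ hex)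
    (semiconj_gBax n G _ _ cc S _ _ heyx) (semiconj_gBax n G _ _ cc S _ _ heyx)
    (semiconj_gBax n G _ _ cc S _ _ hexy).symm (hAB _ _) (hAB _ _)
  · rw [hsdef, ← map_mul, ← map_mul, Equiv.swap_mul_self, map_one, map_one]
  · rw [eE_eq n G i (i + 1) h0 hi, mul_smul_comm, smul_mul_assoc, Finset.sum_mul, Finset.mul_sum]
    congr 1
    refine Fintype.sum_equiv (Equiv.inv G) _ _ fun g => ?_
    rw [((hs0 g).mul_right (hs1 g⁻¹)).eq]
    have hne' : (⟨i, h0⟩ : Fin n) ≠ ⟨i + 1, hi⟩ := by simp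
    rw [← (copyU_commute n G hne' _ _).eq]
    simp
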